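/- Let G be an α_1-metric graph. For every pair of vertices s,t with d(s,t) ≥ 4 there exists a vertex c strictly inside the interval I(s,t) (c ≠ s,t) such that e(c) < max{e(s), e(t)}. Consequently, the diameter of the center C(G) is at most 3 and the radius of the subgraph induced by C(G) is at most 2. -/

import Mathlib

open SimpleGraph

variable {V : Type*}

/-- `Itv G u v x` means `x` lies on a shortest `(u,v)`-path, i.e. `x ∈ I(u,v)`. -/
def Itv (G : SimpleGraph V) (u v x : V) : Prop :=
  G.dist u x + G.dist x v = G.dist u v

/-- `G` is an `α_i`-metric graph. -/
def AlphaI (G : SimpleGraph V) (i : ℕ) : Prop :=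
  ∀ u v w x : V, Itv G u w v → Itv G v x w → G.Adj v w →
    G.dist u v + G.dist v x ≤ G.dist u x + i

/-- Eccentricity of a vertex. -/
noncomputable def ecc (G : SimpleGraph V) [Fintype V] (v : V) : ℕ :=
  Finset.univ.sup (fun u => G.dist v u)

/-- Radius of the graph. -/
noncomputable def grad (G : SimpleGraph V) [Fintype V] [Nonempty V] : ℕ :=
  Finset.univ.inf' Finset.univ_nonempty (fun v => ecc G v)

/-- Diameter of the graph. -/
noncomputable def gdiam (G : SimpleGraph V) [Fintype V] : ℕ :=
  Finset.univ.sup (fun v => ecc G v)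

/-- An integer-valued metric with the interpolation property of a connected graph that satisfies
the `α₁`-condition. -/
structure AlphaOneMetric (d : V → V → ℕ) : Prop where
  self : ∀ x, d x x = 0
  eq_of : ∀ x y, d x y = 0 → x = y
  comm : ∀ x y, d x y = d y x
  tri : ∀ x y z, d x z ≤ d x y + d y z
  mid : ∀ x y n, n ≤ d x y → ∃ z, d x z = n ∧ d z y + n = d x y
  alpha : ∀ u v w x, d v w = 1 → d u v + 1 = d u w → d w x + 1 = d v x →
    d u v + d v x ≤ d u x + 1

namespace AlphaOneMetric

variable {d : V → V → ℕ}

theorem le_of_rise (h : AlphaOneMetric d) {v b c : V} (hcb : 1 ≤ d c b) :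
    ∀ n a, d a c = n → d a c + d c b = d a b → d v a < d v c → d v c ≤ d v b := by
  intro n
  induction n with
  | zero =>
    intro a ha _ hlt
    rw [h.eq_of a c ha] at hlt
    omega
  | succ n ih =>
    intro a ha hab hlt
    obtain ⟨a', h1, h2⟩ := h.mid a c 1 (by omega)
    have t1 := h.tri a' c b
    have t2 := h.tri a a' b
    have t3 := h.tri v a a'
    by_cases hl : d v a' < d v c
    · exact ih a' (by omega) (by omega) hl
    · have := h.alpha v a a' b h1 (by omega) (by omega)
      omega

/-- Disks are convex. -/
theorem convex (h : AlphaOneMetric d) {a b c : V} (v : V) {r : ℕ}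
    (hc : d a c + d c b ≤ d a b) (ha : d v a ≤ r) (hb : d v b ≤ r) : d v c ≤ r := by
  by_contra! hlt
  have t := h.tri a c b
  have hcb : 1 ≤ d c b := by
    by_contra! h0
    rw [h.eq_of c b (by omega)] at hlt
    omega
  have := h.le_of_rise (v := v) hcb (d a c) a rfl (by omega) (by omega)
  omega

/-- The neighbours of `u` in the interval from `u` to `w` form a clique. -/
theorem clique (h : AlphaOneMetric d) {u w x y : V} (hx : d u x ≤ 1) (hy : d u y ≤ 1)
    (hxw : d x w < d u w) (hyw : d y w < d u w) : d x y ≤ 1 := by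
  by_contra! hlt
  have c1 := h.comm u x
  have c2 := h.comm w u
  have c3 := h.comm w x
  have c4 := h.comm w y
  have := h.convex (a := x) (b := y) (c := u) w (r := d u w - 1) (by omega) (by omega) (by omega)
  omega

theorem square (h : AlphaOneMetric d) {a b c e : V} (hab : d a b ≤ 1) (hbc : d b c ≤ 1)
    (hce : d c e ≤ 1) (hea : d e a ≤ 1) : d a c ≤ 1 ∨ d b e ≤ 1 := by
  by_contra! hlt
  have t1 := h.tri a b c
  have t2 := h.tri b c e
  have t3 := h.comm e a
  have := h.alpha a b c e (by omega) (by omega) (by omega)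
  omega

/-- The form of the triangle-pentagon condition in which one neighbour is prescribed. -/
theorem pentagon (h : AlphaOneMetric d) (k : ℕ) : ∀ v x y x', d v x = k + 2 → d v y = k + 2 →
    d x y ≤ 1 → d x x' = 1 → d v x' = k + 1 → ∃ z, d x' z = 1 ∧ d v z = k ∧ d z y ≤ 2 := by
  induction k with
  | zero =>
    intro v x y x' _ hy _ _ hx'
    exact ⟨v, by rw [h.comm]; omega, h.self v, by omega⟩
  | succ k ih =>
    intro v x y x' hx hy hxy hxx' hx'
    have shift : ∀ g w, d x g = 1 → d v g = k + 2 → d g w = 1 → d v w = k + 1 → d w y ≤ 2 →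
        ∃ z, d x' z = 1 ∧ d v z = k + 1 ∧ d z y ≤ 2 := by
      intro g w hxg hg hgw hw hwy
      have hx'g : d x' g ≤ 1 := h.clique (u := x) (w := v) (by omega) (by omega)
        (by have := h.comm v x; have := h.comm v x'; omega)
        (by have := h.comm v x; have := h.comm v g; omega)
      obtain ⟨b, hwb, hb, hbx'⟩ := ih v g x' w hg hx' (by rw [h.comm]; exact hx'g) hgw hw
      obtain ⟨a, hba, hax'⟩ := h.mid b x' 1 (by have := h.tri v b x'; omega)
      have haw : d a w ≤ 1 := h.clique (u := b) (w := x) (by omega)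
        (by rw [h.comm]; omega)
        (by have := h.tri v b x; have := h.tri a x' x; have := h.comm x x'; omega)
        (by have := h.tri v b x; have := h.tri w g x; have := h.comm w g; have := h.comm x g; omega)
      have l1 := h.tri v b a
      have l2 := h.tri v a x'
      have l3 := h.tri x' a w
      have l4 := h.comm x' a
      by_cases hx'w : d x' w ≤ 1
      · exact ⟨w, by have := h.tri v w x'; have := h.comm w x'; omega, hw, hwy⟩
      · refine ⟨a, by omega, by omega, ?_⟩
        rw [h.comm]
        exact h.convex (a := x') (b := w) y (by omega)
          (by have := h.tri y x x'; have := h.comm y x; omega) (by rw [h.comm]; exact hwy)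
    by_cases hx'y : d x' y ≤ 1
    · obtain ⟨z, hz, hzx'⟩ := h.mid v x' (k + 1) (by omega)
      exact ⟨z, by rw [h.comm]; omega, hz, by have := h.tri z x' y; omega⟩
    obtain ⟨y', hy', hyy'⟩ := h.mid v y (k + 2) (by omega)
    have cyy' := h.comm y y'
    by_cases hxy' : d x y' ≤ 1
    · obtain ⟨w, hw, hwy'⟩ := h.mid v y' (k + 1) (by omega)
      exact shift y' w (by have := h.tri v y' x; have := h.comm x y'; omega) hy'
        (by rw [h.comm]; omega) hw (by have := h.tri w y' y; omega)
    have cxx' := h.comm x x'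
    have cxy := h.comm x y
    have tx'y := h.tri x' x y
    have txy' := h.tri x y y'
    have hx'y'_le : d x' y' ≤ 2 := by
      by_contra! hlt
      have := h.convex (a := x') (b := y') (c := x) v (r := k + 2) (by omega) (by omega) (by omega)
      omega
    have hx'y' : d x' y' = 2 := by
      by_contra hne
      have := h.square (a := x) (b := x') (c := y') (e := y) (by omega) (by omega) (by omega)
        (by omega)
      omega
    obtain ⟨m, hx'm, hmy'⟩ := h.mid x' y' 1 (by omega)
    have hm := h.convex (c := m) v (r := k + 2) (by omega) hx'.le hy'.le
    by_cases hm' : d v m ≤ k + 1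
    · exact ⟨m, hx'm, by have := h.tri v m x'; have := h.comm m x'; omega,
        by have := h.tri m y' y; omega⟩
    have key : ∀ z, d v z = k → d z x' ≤ 2 → d z y' ≤ 2 →
        ∃ z, d x' z = 1 ∧ d v z = k + 1 ∧ d z y ≤ 2 := by
      intro z hz hzx' hzy'
      obtain ⟨w, hzw, hwx'⟩ := h.mid z x' 1 (by have := h.tri v z x'; omega)
      obtain ⟨p, hzp, hpy'⟩ := h.mid z y' 1 (by have := h.tri v z y'; omega)
      have hw : d v w = k + 1 := by have := h.tri v z w; have := h.tri v w x'; omega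
      have hp : d v p = k + 1 := by have := h.tri v z p; have := h.tri v p y'; omega
      have cx'w := h.comm x' w
      have txw := h.tri v w x'
      have cx'y := h.comm y x'
      have hpy : d p y ≤ 2 := by have := h.tri p y' y; omega
      have cpy := h.comm p y
      have hwp : d w p ≤ 2 := by have := h.tri w z p; have := h.comm w z; omega
      have tx'p := h.tri x' w p
      by_cases he : d x' w + d w p ≤ d x' p
      · refine ⟨w, by omega, hw, ?_⟩
        rw [h.comm]
        exact h.convex y he (by omega) (by omega)
      · by_cases hwp' : d w p ≤ 1
        · exact ⟨p, by have := h.tri v p x'; have := h.comm p x'; omega, hp, hpy⟩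
        · exfalso
          have hpx := h.convex (a := x') (b := y) (c := x) p (r := 2) (by omega)
            (by have := h.comm p x'; omega) hpy
          have := h.clique (u := z) (w := x) (x := w) (y := p) (by omega) (by omega)
            (by have := h.tri v z x; have := h.tri w x' x; omega)
            (by have := h.tri v z x; omega)
          omega
    obtain ⟨w, hw, hwm⟩ := h.mid v m (k + 1) (by omega)
    have cwm := h.comm w m
    have cmx' := h.comm m x'
    obtain ⟨z, hwz, hz, hzx'⟩ := ih v m x' w (by omega) hx' (by omega) (by omega) hw
    obtain ⟨q, hwq, hq, hqy'⟩ := ih v m y' w (by omega) hy' (by omega) (by omega) hw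
    by_cases hzy' : d z y' ≤ 2
    · exact key z hz hzx' hzy'
    have hzq := h.clique (u := w) (w := v) (x := z) (y := q) (by omega) (by omega)
      (by have := h.comm v z; have := h.comm v w; omega)
      (by have := h.comm v q; have := h.comm v w; omega)
    refine key q hq ?_ hqy'
    rw [h.comm]
    exact h.convex (a := z) (b := y') x' (by have := h.tri z q y'; omega)
      (by rw [h.comm]; exact hzx') (by omega)

/-- A vertex far from a middle vertex of `I(s,t)` is equally far from the neighbouring vertices
of the interval. -/
theorem dist_eq_of_middle (h : AlphaOneMetric d) {s t c v : V} {k : ℕ} (hst : d s t = 4)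
    (hct : d c t = 2) (hvs : d v s ≤ k) (hvt : d v t ≤ k) (hvc : d v c = k)
    {p : V} (hsp : d s p = 1) (hpc : d p c = 1) : d v p = k ∧ d v s = k := by
  have hpt : d p t = 3 := by have := h.tri p c t; have := h.tri s p t; omega
  have hvp := h.convex (a := s) (b := t) (c := p) v (by omega) hvs hvt
  have t1 := h.tri v p c
  have t2 := h.tri v s p
  have hp : d v p = k := by
    by_contra hne
    have := h.alpha v p c t hpc (by omega) (by omega)
    omega
  refine ⟨hp, ?_⟩
  by_contra hne
  have := h.alpha v s p t hsp (by omega) (by omega)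
  omega

/-- Neighbours of a middle vertex `c` of `I(s,t)` towards a vertex far from `c` are middle
vertices as well. -/
theorem middle_of_closer (h : AlphaOneMetric d) {s t c v z : V} {k : ℕ} (hst : d s t = 4)
    (hsc : d s c = 2) (hct : d c t = 2) (hvs : d v s ≤ k) (hvt : d v t ≤ k) (hvc : d v c = k)
    (hcz : d c z = 1) (hvz : d v z + 1 = k) : d s z = 2 ∧ d z t = 2 := by
  have c1 := h.comm c z
  have c2 := h.comm s z
  have c3 := h.comm s c
  have t1 := h.tri s c z
  have t2 := h.tri z c t
  have t3 := h.tri s z t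
  have h1 : d z s ≤ 2 := by
    by_contra! hlt
    have := h.alpha v z c s (by omega) (by omega) (by omega)
    omega
  have h2 : d z t ≤ 2 := by
    by_contra! hlt
    have := h.alpha v z c t (by omega) (by omega) (by omega)
    omega
  omega

theorem exists_common (h : AlphaOneMetric d) {s t c z : V} (hst : d s t = 4)
    (hsc : d s c = 2) (hct : d c t = 2) (hsz : d s z = 2) (hzt : d z t = 2) (hcz : d c z = 1) :
    ∃ p, d s p = 1 ∧ d p c = 1 ∧ d p z = 1 := by
  obtain ⟨p, hsp, hpc⟩ := h.mid s c 1 (by omega)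
  obtain ⟨q, hsq, hqz⟩ := h.mid s z 1 (by omega)
  have hpq := h.clique (u := s) (w := t) (x := p) (y := q) (by omega) (by omega)
    (by have := h.tri p c t; omega) (by have := h.tri q z t; omega)
  have c1 := h.comm z q
  have c2 := h.comm q p
  have c3 := h.comm c q
  rcases h.square (a := p) (b := c) (c := z) (e := q) (by omega) (by omega) (by omega) (by omega)
    with h1 | h1
  · exact ⟨p, hsp, by omega, by have := h.tri s p z; omega⟩
  · exact ⟨q, hsq, by have := h.tri s q c; omega, by omega⟩

theorem exists_closer_neighbour (h : AlphaOneMetric d) {s t v z p q : V} {k : ℕ}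
    (hst : d s t = 4) (hsz : d s z = 2) (hzt : d z t = 2) (hvz : d v z = k + 1)
    (hsp : d s p = 1) (hpz : d p z = 1) (htq : d t q = 1) (hqz : d q z = 1)
    (hvp : d v p = k + 2) (hvs : d v s = k + 2) (hvq : d v q = k + 2) (hvt : d v t = k + 2) :
    ∃ a, d s a = 1 ∧ d a z = 1 ∧ d v a = k + 1 := by
  have c1 := h.comm s p
  have c2 := h.comm t q
  have c3 := h.comm p z
  obtain ⟨x, hzx, hx, hxs⟩ := h.pentagon k v p s z hvp hvs (by omega) hpz hvz
  obtain ⟨y, hzy, hy, hyt⟩ := h.pentagon k v q t z hvq hvt (by omega) hqz hvz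
  have hxy := h.clique (u := z) (w := v) (x := x) (y := y) (by omega) (by omega)
    (by have := h.comm v z; have := h.comm v x; omega)
    (by have := h.comm v z; have := h.comm v y; omega)
  have finish : ∀ x a, d z x = 1 → d v x = k → d x a = 1 → d a s = 1 → d a p ≤ 1 →
      ∃ a, d s a = 1 ∧ d a z = 1 ∧ d v a = k + 1 := by
    intro x a hzx hx hxa has hap
    have l1 := h.tri v x a
    have l2 := h.tri v a s
    have l3 := h.tri v x p
    have l4 := h.comm x a
    have l5 := h.comm p x
    have l6 := h.tri s a z
    have l7 := h.comm s a
    refine ⟨a, by rw [h.comm]; exact has, ?_, by omega⟩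
    rcases h.square (a := a) (b := p) (c := z) (e := x) hap (by omega) (by omega) (by omega)
      with h1 | h1 <;> omega
  by_cases hys : d y s ≤ 2
  · obtain ⟨a, hya, has⟩ := h.mid y s 1 (by have := h.tri v y s; omega)
    have l1 := h.tri v y s
    have l2 := h.comm a s
    have l3 := h.comm y a
    refine finish y a hzy hy hya (by omega) (h.clique (u := s) (w := t) (by omega) (by omega) ?_ ?_)
    · have := h.tri a y t
      omega
    · have := h.tri p z t
      omega
  · obtain ⟨a, hxa, has⟩ := h.mid x s 1 (by have := h.tri v x s; omega)
    have l1 := h.tri v x s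
    refine finish x a hzx hx hxa (by omega) ?_
    by_contra! hap
    have := h.convex (a := a) (b := p) (c := s) y (r := 2) (by omega)
      (by have := h.tri y x a; have := h.comm x y; omega)
      (by have := h.tri y z p; have := h.comm z y; omega)
    omega

/-- Adjacent middle vertices `c`, `z` of `I(s,t)` cannot separate the vertices far from
each of them. -/
theorem not_opposite_far (h : AlphaOneMetric d) {s t c z v u : V} {k : ℕ} (hst : d s t = 4)
    (hsc : d s c = 2) (hct : d c t = 2) (hsz : d s z = 2) (hzt : d z t = 2) (hcz : d c z = 1)
    (hs : ∀ w, d w s ≤ k + 2) (ht : ∀ w, d w t ≤ k + 2) (hv : d v c = k + 2)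
    (hvz : d v z = k + 1) (huz : d u z = k + 2) (huc : d u c = k + 1) : False := by
  have hts : d t s = 4 := by rw [h.comm]; exact hst
  have htc : d t c = 2 := by rw [h.comm]; exact hct
  have hcs : d c s = 2 := by rw [h.comm]; exact hsc
  have htz : d t z = 2 := by rw [h.comm]; exact hzt
  have hzs : d z s = 2 := by rw [h.comm]; exact hsz
  obtain ⟨p, hsp, hpc, hpz⟩ := h.exists_common hst hsc hct hsz hzt hcz
  obtain ⟨q, htq, hqc, hqz⟩ := h.exists_common hts htc hcs htz hzs hcz
  obtain ⟨hvp, hvs⟩ := h.dist_eq_of_middle hst hct (hs v) (ht v) hv hsp hpc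
  obtain ⟨hvq, hvt⟩ := h.dist_eq_of_middle hts hcs (ht v) (hs v) hv htq hqc
  obtain ⟨hup, hus⟩ := h.dist_eq_of_middle hst hzt (hs u) (ht u) huz hsp hpz
  obtain ⟨huq, hut⟩ := h.dist_eq_of_middle hts hzs (ht u) (hs u) huz htq hqz
  obtain ⟨a, hsa, haz, hva⟩ := h.exists_closer_neighbour (v := v) hst hsz hzt
    hvz hsp hpz htq hqz hvp hvs hvq hvt
  obtain ⟨b, hsb, hbc, hub⟩ := h.exists_closer_neighbour (v := u) hst hsc hct
    huc hsp hpc htq hqc hup hus huq hut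
  have hab := h.clique (u := s) (w := t) (x := a) (y := b) (by omega) (by omega)
    (by have := h.tri a z t; omega) (by have := h.tri b c t; omega)
  have c1 := h.comm b a
  have c2 := h.comm c b
  have c3 := h.comm z c
  have c4 := h.comm z b
  rcases h.square (a := a) (b := z) (c := c) (e := b) (by omega) (by omega) (by omega) (by omega)
    with h1 | h1
  · have := (h.dist_eq_of_middle hst hct (hs v) (ht v) hv hsa
      (by have := h.tri s a c; omega)).1
    omega
  · have := (h.dist_eq_of_middle hst hzt (hs u) (ht u) huz hsb
      (by have := h.tri s b z; omega)).1
    omega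

/-- Some `c ∈ S` is minimal for inclusion of the set of vertices of `C` at distance `k`. -/
theorem exists_min_far (d : V → V → ℕ) (k : ℕ) (C S : Finset V) (hS : S.Nonempty) :
    ∃ c ∈ S, ∀ v ∈ C, d v c = k → ∀ z ∈ S, d v z ≠ k → ∃ u ∈ C, d u z = k ∧ d u c ≠ k := by
  classical
  obtain ⟨c, hc, hmin⟩ := S.exists_min_image (fun c => (C.filter fun v => d v c = k).card) hS
  refine ⟨c, hc, fun v hv hvc z hz hvz => ?_⟩
  by_contra! hsub
  refine (hmin z hz).not_gt (Finset.card_lt_card ?_)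
  refine (Finset.ssubset_iff_of_subset fun u hu => ?_).2
    ⟨v, Finset.mem_filter.2 ⟨hv, hvc⟩, fun hvz' => hvz (Finset.mem_filter.1 hvz').2⟩
  obtain ⟨hu, huz⟩ := Finset.mem_filter.1 hu
  exact Finset.mem_filter.2 ⟨hu, hsub u hu huz⟩

/-- Two vertices at distance 4 have a vertex strictly between them that is closer to
everything than the common radius of two disks around the ends that cover the space. -/
theorem exists_between_lt [Fintype V] (h : AlphaOneMetric d) {s t : V} {k : ℕ}
    (hst : d s t = 4) (hs : ∀ v, d v s ≤ k) (ht : ∀ v, d v t ≤ k) :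
    ∃ c, d s c = 2 ∧ d c t = 2 ∧ ∀ v, d v c < k := by
  classical
  by_contra! hno
  obtain ⟨c₀, hc₀⟩ := h.mid s t 2 (by omega)
  obtain ⟨c, hc, hmin⟩ := exists_min_far d k Finset.univ
    (Finset.univ.filter fun c => d s c = 2 ∧ d c t = 2)
    ⟨c₀, by simp only [Finset.mem_filter, Finset.mem_univ, true_and]; omega⟩
  simp only [Finset.mem_filter, Finset.mem_univ, true_and, true_imp_iff] at hc hmin
  obtain ⟨hsc, hct⟩ := hc
  have far : ∀ z, d s z = 2 → d z t = 2 → ∀ v, d v z ≤ k := fun z h1 h2 v =>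
    h.convex (a := s) (b := t) v (by omega) (hs v) (ht v)
  have hk : 4 ≤ k := by have := ht s; omega
  obtain ⟨v, hv⟩ := hno c hsc hct
  replace hv : d v c = k := le_antisymm (far c hsc hct v) hv
  obtain ⟨z, hvz, hzc⟩ := h.mid v c (k - 1) (by omega)
  have hcz : d c z = 1 := by rw [h.comm]; omega
  obtain ⟨hsz, hzt⟩ := h.middle_of_closer hst hsc hct (hs v) (ht v) hv hcz (by omega)
  obtain ⟨u, huz, huc⟩ := hmin v hv z ⟨hsz, hzt⟩ (by omega)
  have huc' : d u c + 1 = k := by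
    have := far c hsc hct u
    have := h.tri u c z
    omega
  exact h.not_opposite_far (v := v) (u := u) (k := k - 2) hst hsc hct hsz hzt hcz
    (fun w => (hs w).trans (by omega)) (fun w => (ht w).trans (by omega))
    (by omega) (by omega) (by omega) (by omega)

/-- A nonempty convex set of diameter at most 3 has radius at most 2. -/
theorem exists_dist_le_two (h : AlphaOneMetric d) (C : Finset V) (hne : C.Nonempty)
    (hconv : ∀ x ∈ C, ∀ y ∈ C, ∀ z, d x z + d z y = d x y → z ∈ C)
    (hdiam : ∀ x ∈ C, ∀ y ∈ C, d x y ≤ 3) : ∃ c ∈ C, ∀ x ∈ C, d c x ≤ 2 := by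
  obtain ⟨c, hc, hmin⟩ := exists_min_far d 3 C C hne
  refine ⟨c, hc, fun v hv => ?_⟩
  by_contra! hlt
  have hvc : d v c = 3 := by have := hdiam v hv c hc; have := h.comm v c; omega
  obtain ⟨z, hvz, hzc⟩ := h.mid v c 2 (by omega)
  have hz := hconv v hv c hc z (by omega)
  obtain ⟨u, hu, huz, huc⟩ := hmin v hv hvc z hz (by omega)
  have t1 := h.tri u c z
  have c1 := h.comm c z
  have c2 := h.comm c u
  have c3 := h.comm z u
  have t2 := hdiam u hu c hc
  have t3 := hdiam v hv u hu
  have := h.alpha v z c u (by omega) (by omega) (by omega)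
  omega

end AlphaOneMetric

theorem SimpleGraph.Connected.alphaOneMetric {G : SimpleGraph V} (hG : G.Connected)
    (hα : AlphaI G 1) : AlphaOneMetric G.dist where
  self _ := SimpleGraph.dist_self
  eq_of _ _ := hG.dist_eq_zero_iff.1
  comm _ _ := SimpleGraph.dist_comm
  tri _ _ _ := hG.dist_triangle
  mid x y n hn := by
    obtain ⟨p, hp⟩ := hG.exists_walk_length_eq_dist x y
    have h1 := SimpleGraph.dist_le (p.take n)
    have h2 := SimpleGraph.dist_le (p.drop n)
    have h3 := hG.dist_triangle (u := x) (v := p.getVert n) (w := y)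
    rw [SimpleGraph.Walk.take_length] at h1
    rw [SimpleGraph.Walk.drop_length] at h2
    exact ⟨p.getVert n, by omega, by omega⟩
  alpha u v w x h1 h2 h3 :=
    hα u v w x (by unfold Itv; omega) (by unfold Itv; omega)
      (SimpleGraph.dist_eq_one_iff_adj.1 h1)

theorem dist_le_ecc [Fintype V] (G : SimpleGraph V) (u v : V) : G.dist u v ≤ ecc G v := by
  rw [SimpleGraph.dist_comm]
  exact Finset.le_sup (f := fun u => G.dist v u) (Finset.mem_univ u)

theorem grad_le_ecc [Fintype V] [Nonempty V] (G : SimpleGraph V) (v : V) : grad G ≤ ecc G v :=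
  Finset.inf'_le _ (Finset.mem_univ v)

theorem ecc_le_of_itv [Fintype V] {G : SimpleGraph V} (h : AlphaOneMetric G.dist) {x y z : V}
    {k : ℕ} (hz : Itv G x y z) (hx : ecc G x ≤ k) (hy : ecc G y ≤ k) : ecc G z ≤ k := by
  refine Finset.sup_le fun v _ => ?_
  rw [h.comm]
  exact h.convex v hz.le ((dist_le_ecc G v x).trans hx) ((dist_le_ecc G v y).trans hy)

theorem stmt_17 [Fintype V] [Nonempty V] (G : SimpleGraph V) (hG : G.Connected)
    (hα : AlphaI G 1) :
    (∀ s t : V, 4 ≤ G.dist s t →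
      ∃ c : V, Itv G s t c ∧ c ≠ s ∧ c ≠ t ∧ ecc G c < max (ecc G s) (ecc G t)) ∧
    (∀ x y : V, ecc G x = grad G → ecc G y = grad G → G.dist x y ≤ 3) ∧
    (∃ c : {v : V // ecc G v = grad G}, ∀ x : {v : V // ecc G v = grad G},
      (G.induce {v : V | ecc G v = grad G}).dist c x ≤ 2) := by
  have h := hG.alphaOneMetric hα
  have between : ∀ s t : V, 4 ≤ G.dist s t →
      ∃ c : V, Itv G s t c ∧ c ≠ s ∧ c ≠ t ∧ ecc G c < max (ecc G s) (ecc G t) := by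
    intro s t hst
    obtain ⟨s', hs, hs'⟩ := h.mid s t (G.dist s t - 4) (by omega)
    have hs'k : ecc G s' ≤ max (ecc G s) (ecc G t) :=
      ecc_le_of_itv h (x := s) (y := t) (by unfold Itv; omega) (le_max_left _ _) (le_max_right _ _)
    obtain ⟨c, h1, h2, hc⟩ := h.exists_between_lt (s := s') (t := t)
      (k := max (ecc G s) (ecc G t)) (by omega) (fun v => (dist_le_ecc G v s').trans hs'k)
      (fun v => (dist_le_ecc G v t).trans (le_max_right _ _))
    have t1 := h.tri s s' c
    have t2 := h.tri s c t
    refine ⟨c, by unfold Itv; omega, ?_, ?_, ?_⟩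
    · rintro rfl
      omega
    · rintro rfl
      have := h.self c
      omega
    · refine (Finset.sup_lt_iff ((Nat.zero_le _).trans_lt (hc s))).2 fun v _ => ?_
      rw [h.comm]
      exact hc v
  have diam : ∀ x y : V, ecc G x = grad G → ecc G y = grad G → G.dist x y ≤ 3 := by
    intro x y hx hy
    by_contra! hlt
    obtain ⟨c, -, -, -, hc⟩ := between x y hlt
    have := grad_le_ecc G c
    omega
  have conv : ∀ x y z : V, ecc G x = grad G → ecc G y = grad G → Itv G x y z →
      ecc G z = grad G := fun x y z hx hy hz =>
    le_antisymm (ecc_le_of_itv h hz hx.le hy.le) (grad_le_ecc G z)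
  refine ⟨between, diam, ?_⟩
  classical
  obtain ⟨c₀, -, hc₀⟩ := Finset.exists_mem_eq_inf' Finset.univ_nonempty (fun v => ecc G v)
  obtain ⟨c, hc, hcx⟩ := h.exists_dist_le_two (Finset.univ.filter fun v => ecc G v = grad G)
    ⟨c₀, Finset.mem_filter.2 ⟨Finset.mem_univ _, hc₀.symm⟩⟩
    (by
      simp only [Finset.mem_filter, Finset.mem_univ, true_and]
      exact fun x hx y hy z hz => conv x y z hx hy hz)
    (by
      simp only [Finset.mem_filter, Finset.mem_univ, true_and]
      exact fun x hx y hy => diam x y hx hy)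
  simp only [Finset.mem_filter, Finset.mem_univ, true_and] at hc hcx
  refine ⟨⟨c, hc⟩, fun ⟨x, hx⟩ => ?_⟩
  have hle := hcx x hx
  obtain ⟨m, hm, hmx⟩ := h.mid c x (G.dist c x - 1) (by omega)
  have hmC : ecc G m = grad G := conv c x m hc hx (by unfold Itv; omega)
  have lift : ∀ u v : {v : V // ecc G v = grad G}, G.dist u v ≤ 1 →
      ∃ p : (G.induce {v : V | ecc G v = grad G}).Walk u v, p.length ≤ 1 := by
    rintro ⟨u, hu⟩ ⟨v, hv⟩ huv
    rcases Nat.le_one_iff_eq_zero_or_eq_one.1 huv with h0 | h1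
    · obtain rfl : u = v := h.eq_of _ _ h0
      exact ⟨.nil, by simp⟩
    · have hadj : (G.induce {v : V | ecc G v = grad G}).Adj ⟨u, hu⟩ ⟨v, hv⟩ :=
        SimpleGraph.induce_adj.2 (SimpleGraph.dist_eq_one_iff_adj.1 h1)
      exact ⟨hadj.toWalk, by simp⟩
  obtain ⟨p, hp⟩ := lift ⟨c, hc⟩ ⟨m, hmC⟩ (by change G.dist c m ≤ 1; omega)
  obtain ⟨q, hq⟩ := lift ⟨m, hmC⟩ ⟨x, hx⟩ (by change G.dist m x ≤ 1; omega)
  refine (SimpleGraph.dist_le (p.append q)).trans ?_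
  rw [SimpleGraph.Walk.length_append]
  omega
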